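/- Let B be a bialgebra and let B ⊘ B denote the quotient (B ⊗ B)/((B ⊗ B)·Δ(B⁺)), where B⁺ = ker ε and B⊗B acts diagonally on the right. Then B ⊘ B carries a well-defined coalgebra structure given by Δ(x ⊘ y) = (x₁ ⊘ y₂) ⊗ (x₂ ⊘ y₁) and ε(x ⊘ y) = ε(x)ε(y), and a left B ⊗ B-module structure (a ⊗ b)·(x ⊘ y) = ax ⊘ by, making B ⊘ B a quotient coalgebra of B ⊗ B^cop. -/

import Mathlib

noncomputable section
open TensorProduct LinearMap

/-- Convolution product of linear maps from a bialgebra to an algebra. -/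
def conv {k B A : Type*} [CommRing k] [Ring B] [Bialgebra k B]
    [Ring A] [Algebra k A] (f g : B →ₗ[k] A) : B →ₗ[k] A :=
  LinearMap.mul' k A ∘ₗ TensorProduct.map f g ∘ₗ Coalgebra.comul

/-- Unit of the convolution algebra: u ∘ ε. -/
def convUnit (k B A : Type*) [CommRing k] [Ring B] [Bialgebra k B]
    [Ring A] [Algebra k A] : B →ₗ[k] A :=
  Algebra.linearMap k A ∘ₗ Coalgebra.counit

/-- n-th convolution power of the identity. -/
def convPow (k B : Type*) [CommRing k] [Ring B] [Bialgebra k B] : ℕ → (B →ₗ[k] B)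
  | 0 => convUnit k B B
  | n + 1 => conv (convPow k B n) LinearMap.id

/-- The submodule (B ⊗ B)·Δ(ker ε) of B ⊗ B. -/
def oslashRel (k B : Type*) [CommRing k] [Ring B] [Bialgebra k B] :
    Submodule k (B ⊗[k] B) :=
  Submodule.span k {z | ∃ (m : B ⊗[k] B) (b : B),
    Coalgebra.counit (R := k) b = 0 ∧ z = m * Coalgebra.comul b}

/-- B ⊘ B. -/
abbrev Oslash (k B : Type*) [CommRing k] [Ring B] [Bialgebra k B] :=
  (B ⊗[k] B) ⧸ oslashRel k B

/-- The class of x ⊗ y in B ⊘ B. -/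
abbrev omk (k : Type*) {B : Type*} [CommRing k] [Ring B] [Bialgebra k B]
    (z : B ⊗[k] B) : Oslash k B := Submodule.Quotient.mk z

/-- i_B : B → B ⊘ B, b ↦ b ⊘ 1. -/
def iB (k B : Type*) [CommRing k] [Ring B] [Bialgebra k B] : B →ₗ[k] Oslash k B :=
  (oslashRel k B).mkQ ∘ₗ (TensorProduct.mk k B B).flip 1

/-- The diagonal right coaction of B on B ⊗ B: Σ x₁ ⊗ y₁ ⊗ x₂y₂. -/
def coact (k B : Type*) [CommRing k] [Ring B] [Bialgebra k B] :
    (B ⊗[k] B) →ₗ[k] (B ⊗[k] B) ⊗[k] B :=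
  (TensorProduct.map LinearMap.id (LinearMap.mul' k B)) ∘ₗ
    (TensorProduct.tensorTensorTensorComm k B B B B).toLinearMap ∘ₗ
    (TensorProduct.map Coalgebra.comul Coalgebra.comul)

/-- z ↦ z ⊗ 1. -/
def unitR (k B : Type*) [CommRing k] [Ring B] [Bialgebra k B] :
    (B ⊗[k] B) →ₗ[k] (B ⊗[k] B) ⊗[k] B :=
  (TensorProduct.map LinearMap.id (Algebra.linearMap k B)) ∘ₗ
    (TensorProduct.rid k (B ⊗[k] B)).symm.toLinearMap

/-- B ⧄ B : the coinvariants of B ⊗ B. -/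
def coinv (k B : Type*) [CommRing k] [Ring B] [Bialgebra k B] :
    Submodule k (B ⊗[k] B) :=
  LinearMap.eqLocus (coact k B) (unitR k B)

/-- Σ x ⊗ y ↦ Σ x ε(y), on all of B ⊗ B. -/
def pB0 (k B : Type*) [CommRing k] [Ring B] [Bialgebra k B] :
    (B ⊗[k] B) →ₗ[k] B :=
  (TensorProduct.rid k B).toLinearMap ∘ₗ TensorProduct.map LinearMap.id Coalgebra.counit

/-- Σ x ⊗ y ↦ Σ ε(x) y, on all of B ⊗ B. -/
def qB0 (k B : Type*) [CommRing k] [Ring B] [Bialgebra k B] :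
    (B ⊗[k] B) →ₗ[k] B :=
  (TensorProduct.lid k B).toLinearMap ∘ₗ TensorProduct.map Coalgebra.counit LinearMap.id

/-- p_B : B ⧄ B → B. -/
def pB (k B : Type*) [CommRing k] [Ring B] [Bialgebra k B] :
    coinv k B →ₗ[k] B :=
  pB0 k B ∘ₗ (coinv k B).subtype

/-- The map x ⊗ y ↦ (x₁ ⊗ y₂) ⊗ (x₂ ⊗ y₁). -/
def coDelta0 (k B : Type*) [CommRing k] [Ring B] [Bialgebra k B] :
    (B ⊗[k] B) →ₗ[k] (B ⊗[k] B) ⊗[k] (B ⊗[k] B) :=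
  (TensorProduct.tensorTensorTensorComm k B B B B).toLinearMap ∘ₗ
    (TensorProduct.map LinearMap.id (TensorProduct.comm k B B).toLinearMap) ∘ₗ
    (TensorProduct.map Coalgebra.comul Coalgebra.comul)

section Helpers
variable {k B : Type*} [Field k] [Ring B] [Bialgebra k B]

/-- Reversal of the three tensor factors. -/
def rev3 (k B : Type*) [Field k] [Ring B] [Bialgebra k B] :
    B ⊗[k] (B ⊗[k] B) →ₗ[k] B ⊗[k] (B ⊗[k] B) :=
  (TensorProduct.assoc k B B B).toLinearMap ∘ₗ (TensorProduct.comm k B (B ⊗[k] B)).toLinearMap ∘ₗ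
    (TensorProduct.comm k B B).toLinearMap.lTensor B

/-- The co-opposite coalgebra structure. -/
@[reducible]
def copC (k B : Type*) [Field k] [Ring B] [Bialgebra k B] : Coalgebra k B where
  comul := (TensorProduct.comm k B B).toLinearMap ∘ₗ Coalgebra.comul
  counit := Coalgebra.counit
  coassoc := by
    ext b
    have h := congrArg (rev3 k B) (Coalgebra.coassoc_apply (R := k) b).symm
    convert h using 1
    · simp only [LinearMap.comp_apply, LinearEquiv.coe_coe]
      induction Coalgebra.comul (R := k) b with
      | zero => simp
      | add x y hx hy => simp only [map_add, hx, hy]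
      | tmul x y =>
        simp only [TensorProduct.comm_tmul, LinearMap.rTensor_tmul, LinearMap.lTensor_tmul,
          LinearMap.comp_apply, LinearEquiv.coe_coe, rev3]
    · simp only [LinearMap.comp_apply, LinearEquiv.coe_coe]
      induction Coalgebra.comul (R := k) b with
      | zero => simp
      | add x y hx hy => simp only [map_add, hx, hy]
      | tmul x y =>
        simp only [TensorProduct.comm_tmul, LinearMap.rTensor_tmul, LinearMap.lTensor_tmul,
          LinearMap.comp_apply, LinearEquiv.coe_coe]
        induction Coalgebra.comul (R := k) x with
        | zero => simp
        | add u v hx hy => simp only [map_add, TensorProduct.tmul_add, TensorProduct.add_tmul, hx, hy]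
        | tmul u v => simp [rev3]
  rTensor_counit_comp_comul := by
    ext b
    have h := congrArg (TensorProduct.comm k B k) (Coalgebra.lTensor_counit_comul (R := k) b)
    simp only [LinearMap.comp_apply, LinearEquiv.coe_coe]
    rw [TensorProduct.comm_tmul] at h
    refine Eq.trans ?_ h
    induction Coalgebra.comul (R := k) b with
    | zero => simp
    | add x y hx hy => simp only [map_add, hx, hy]
    | tmul x y => simp
  lTensor_counit_comp_comul := by
    ext b
    have h := congrArg (TensorProduct.comm k k B) (Coalgebra.rTensor_counit_comul (R := k) b)
    simp only [LinearMap.comp_apply, LinearEquiv.coe_coe]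
    rw [TensorProduct.comm_tmul] at h
    refine Eq.trans ?_ h
    induction Coalgebra.comul (R := k) b with
    | zero => simp
    | add x y hx hy => simp only [map_add, hx, hy]
    | tmul x y => simp

/-- The coalgebra structure on `B ⊗ B^cop`. -/
@[reducible]
def bbcop (k B : Type*) [Field k] [Ring B] [Bialgebra k B] : Coalgebra k (B ⊗[k] B) :=
  @TensorProduct.instCoalgebra k k B B _ _ _ _ _ _ _ _ _ (copC k B) _

theorem bbcop_comul : (bbcop k B).comul = coDelta0 k B := by
  ext x y
  rfl

theorem bbcop_counit : (bbcop k B).counit =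
    LinearMap.mul' k k ∘ₗ TensorProduct.map Coalgebra.counit Coalgebra.counit := by
  ext x y
  simp only [TensorProduct.AlgebraTensorModule.curry_apply, TensorProduct.curry_apply,
    LinearMap.coe_restrictScalars, LinearMap.comp_apply, TensorProduct.map_tmul,
    LinearMap.mul'_apply]
  exact mul_comm _ _

theorem coDelta0_mul (x y : B ⊗[k] B) : coDelta0 k B (x * y) = coDelta0 k B x * coDelta0 k B y :=
  map_mul ((Algebra.TensorProduct.tensorTensorTensorComm k k k k B B B B).toAlgHom.comp
    ((Algebra.TensorProduct.map (AlgHom.id k (B ⊗[k] B))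
        (Algebra.TensorProduct.comm k B B).toAlgHom).comp
      (Algebra.TensorProduct.map (Bialgebra.comulAlgHom k B) (Bialgebra.comulAlgHom k B)))) x y

/-- `(x ⊗ (y ⊗ z)) ⊗ w ↦ (x ⊗ w) ⊗ (y ⊗ z)`. -/
def hMap (k B : Type*) [Field k] [Ring B] [Bialgebra k B] :
    (B ⊗[k] (B ⊗[k] B)) ⊗[k] B →ₗ[k] (B ⊗[k] B) ⊗[k] (B ⊗[k] B) :=
  (TensorProduct.rightComm k B (B ⊗[k] B) B).toLinearMap

theorem hMap_tmul (x w : B) (t : B ⊗[k] B) : hMap k B ((x ⊗ₜ t) ⊗ₜ w) = (x ⊗ₜ w) ⊗ₜ t := rfl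

/-- `x ⊗ w ↦ (x₁ ⊗ w) ⊗ Δ x₂`. -/
def lMap (k B : Type*) [Field k] [Ring B] [Bialgebra k B] :
    B ⊗[k] B →ₗ[k] (B ⊗[k] B) ⊗[k] (B ⊗[k] B) :=
  hMap k B ∘ₗ ((Coalgebra.comul (R := k) (A := B)).lTensor B ∘ₗ Coalgebra.comul).rTensor B

/-- `x ⊗ (y ⊗ w) ↦ (x₁ ⊗ w) ⊗ (x₂ ⊗ y)`. -/
def gMap (k B : Type*) [Field k] [Ring B] [Bialgebra k B] :
    B ⊗[k] (B ⊗[k] B) →ₗ[k] (B ⊗[k] B) ⊗[k] (B ⊗[k] B) :=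
  (TensorProduct.tensorTensorTensorComm k B B B B).toLinearMap ∘ₗ
    (TensorProduct.map Coalgebra.comul (TensorProduct.comm k B B).toLinearMap)

theorem coDelta0_eq (z : B ⊗[k] B) :
    coDelta0 k B z = gMap k B ((Coalgebra.comul (R := k) (A := B)).lTensor B z) := by
  induction z with
  | zero => simp
  | add x y hx hy => simp only [map_add, hx, hy]
  | tmul x y => simp [coDelta0, gMap]

theorem gMap_assoc (z : B ⊗[k] B) :
    gMap k B (TensorProduct.assoc k B B B ((Coalgebra.comul (R := k) (A := B)).rTensor B z))
      = lMap k B z := by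
  induction z with
  | zero => simp
  | add x y hx hy => simp only [map_add, hx, hy]
  | tmul x w =>
    simp only [lMap, LinearMap.comp_apply, LinearMap.rTensor_tmul]
    rw [← Coalgebra.coassoc_apply]
    induction Coalgebra.comul (R := k) x with
    | zero => simp
    | add u v hu hv => simp only [map_add, TensorProduct.add_tmul, hu, hv]
    | tmul u v =>
      simp only [gMap, TensorProduct.assoc_tmul, LinearMap.comp_apply, TensorProduct.map_tmul,
        LinearEquiv.coe_coe, TensorProduct.comm_tmul, LinearMap.rTensor_tmul]
      induction Coalgebra.comul (R := k) u with
      | zero => simp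
      | add u v hu hv => simp only [map_add, TensorProduct.add_tmul, hu, hv]
      | tmul a b => simp [hMap_tmul]

theorem coDelta0_comul (b : B) :
    coDelta0 k B (Coalgebra.comul b) = lMap k B (Coalgebra.comul b) := by
  rw [coDelta0_eq, ← Coalgebra.coassoc_apply, gMap_assoc]

theorem mkQ_mul_comul (m : B ⊗[k] B) (b : B) :
    (oslashRel k B).mkQ (m * Coalgebra.comul b)
      = Coalgebra.counit (R := k) b • (oslashRel k B).mkQ m := by
  have h : m * Coalgebra.comul (b - algebraMap k B (Coalgebra.counit b)) ∈ oslashRel k B :=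
    Submodule.subset_span ⟨m, _, by simp, rfl⟩
  rw [← map_smul, ← sub_eq_zero, ← map_sub, Submodule.mkQ_apply, Submodule.Quotient.mk_eq_zero]
  convert h using 1
  rw [map_sub, mul_sub, Bialgebra.comul_algebraMap, Algebra.algebraMap_eq_smul_one, mul_smul_comm,
    mul_one]

theorem map_mul_hMap (m n t : B ⊗[k] B) (w : B) :
    TensorProduct.map (oslashRel k B).mkQ (oslashRel k B).mkQ
      ((m ⊗ₜ n) * hMap k B ((Coalgebra.comul (R := k) (A := B)).lTensor B t ⊗ₜ w))
    = (oslashRel k B).mkQ (m * ((TensorProduct.rid k B)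
        ((Coalgebra.counit (R := k) (A := B)).lTensor B t) ⊗ₜ w)) ⊗ₜ (oslashRel k B).mkQ n := by
  induction t with
  | zero => simp
  | add u v hu hv => simp only [map_add, TensorProduct.add_tmul, mul_add, hu, hv]
  | tmul x y =>
    rw [LinearMap.lTensor_tmul, hMap_tmul, Algebra.TensorProduct.tmul_mul_tmul,
      TensorProduct.map_tmul, mkQ_mul_comul, LinearMap.lTensor_tmul, TensorProduct.rid_tmul,
      ← TensorProduct.smul_tmul', mul_smul_comm, map_smul, TensorProduct.tmul_smul,
      TensorProduct.smul_tmul']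

theorem map_mul_lMap (m n z : B ⊗[k] B) :
    TensorProduct.map (oslashRel k B).mkQ (oslashRel k B).mkQ ((m ⊗ₜ n) * lMap k B z)
    = (oslashRel k B).mkQ (m * z) ⊗ₜ (oslashRel k B).mkQ n := by
  induction z with
  | zero => simp
  | add u v hu hv => simp only [map_add, TensorProduct.add_tmul, mul_add, hu, hv]
  | tmul x w =>
    rw [lMap, LinearMap.comp_apply, LinearMap.rTensor_tmul, LinearMap.comp_apply, map_mul_hMap,
      Coalgebra.lTensor_counit_comul, TensorProduct.rid_tmul, one_smul]

theorem map_mul_coDelta0 (M : (B ⊗[k] B) ⊗[k] (B ⊗[k] B)) (b : B)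
    (hb : Coalgebra.counit (R := k) b = 0) :
    TensorProduct.map (oslashRel k B).mkQ (oslashRel k B).mkQ
      (M * coDelta0 k B (Coalgebra.comul b)) = 0 := by
  induction M with
  | zero => simp
  | add u v hu hv => rw [add_mul, map_add, hu, hv, add_zero]
  | tmul m n =>
    rw [coDelta0_comul, map_mul_lMap, mkQ_mul_comul, hb, zero_smul, TensorProduct.zero_tmul]

theorem rel_le_ker_comul : oslashRel k B ≤ LinearMap.ker
    ((TensorProduct.map (oslashRel k B).mkQ (oslashRel k B).mkQ) ∘ₗ coDelta0 k B) := by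
  refine Submodule.span_le.2 ?_
  rintro _ ⟨m, b, hb, rfl⟩
  rw [SetLike.mem_coe, LinearMap.mem_ker, LinearMap.comp_apply, coDelta0_mul]
  exact map_mul_coDelta0 _ b hb

theorem counit2_mul_comul (m : B ⊗[k] B) (b : B) :
    (LinearMap.mul' k k ∘ₗ TensorProduct.map Coalgebra.counit Coalgebra.counit)
      (m * Coalgebra.comul (R := k) b) =
    (LinearMap.mul' k k ∘ₗ TensorProduct.map Coalgebra.counit Coalgebra.counit) m *
      Coalgebra.counit (R := k) b := by
  have hmul := map_mul ((Algebra.TensorProduct.lmul' k (S := k)).comp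
    (Algebra.TensorProduct.map (Bialgebra.counitAlgHom k B) (Bialgebra.counitAlgHom k B)))
      m (Coalgebra.comul (R := k) b)
  refine hmul.trans ?_
  refine congrArg₂ (· * ·) rfl ?_
  have h := congrArg (fun z => Coalgebra.counit (R := k) (TensorProduct.lid k B z))
    (Coalgebra.rTensor_counit_comul (R := k) b)
  simp only [TensorProduct.lid_tmul, one_smul] at h
  rw [← h]
  induction Coalgebra.comul (R := k) b with
  | zero => simp
  | add u v hu hv => simp only [map_add, hu, hv]
  | tmul x y => simp

theorem rel_le_ker_counit : oslashRel k B ≤ LinearMap.ker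
    (LinearMap.mul' k k ∘ₗ TensorProduct.map (Coalgebra.counit (R := k) (A := B))
      (Coalgebra.counit (R := k) (A := B))) := by
  refine Submodule.span_le.2 ?_
  rintro _ ⟨m, b, hb, rfl⟩
  rw [SetLike.mem_coe, LinearMap.mem_ker, counit2_mul_comul, hb, mul_zero]

theorem rel_mul (m : B ⊗[k] B) :
    oslashRel k B ≤ (oslashRel k B).comap (LinearMap.mulLeft k m) := by
  refine Submodule.span_le.2 ?_
  rintro _ ⟨m', b, hb, rfl⟩
  exact Submodule.subset_span ⟨m * m', b, hb, by simp [mul_assoc]⟩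

/-- The left action. -/
def muMap (k B : Type*) [Field k] [Ring B] [Bialgebra k B] :
    (B ⊗[k] B) →ₗ[k] Oslash k B →ₗ[k] Oslash k B where
  toFun m := (oslashRel k B).mapQ (oslashRel k B) (LinearMap.mulLeft k m) (rel_mul m)
  map_add' m n := by
    apply Submodule.linearMap_qext
    refine LinearMap.ext fun z => ?_
    simp [add_mul]
  map_smul' c m := by
    apply Submodule.linearMap_qext
    refine LinearMap.ext fun z => ?_
    simp

theorem muMap_mk (m z : B ⊗[k] B) : muMap k B m (omk k z) = omk k (m * z) := rfl

/-- A quotient of a coalgebra by a compatible surjection is a coalgebra. -/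
theorem quot_coalg {k C Q : Type*} [Field k] [AddCommGroup C] [Module k C] [Coalgebra k C]
    [AddCommGroup Q] [Module k Q] (p : C →ₗ[k] Q) (hp : Function.Surjective p)
    (D : Q →ₗ[k] Q ⊗[k] Q) (e : Q →ₗ[k] k)
    (hD : D ∘ₗ p = TensorProduct.map p p ∘ₗ Coalgebra.comul)
    (he : e ∘ₗ p = Coalgebra.counit) :
    (TensorProduct.assoc k Q Q Q).toLinearMap ∘ₗ (TensorProduct.map D LinearMap.id) ∘ₗ D
        = (TensorProduct.map LinearMap.id D) ∘ₗ D ∧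
      (TensorProduct.lid k Q).toLinearMap ∘ₗ
          (TensorProduct.map e LinearMap.id) ∘ₗ D = LinearMap.id ∧
      (TensorProduct.rid k Q).toLinearMap ∘ₗ
          (TensorProduct.map LinearMap.id e) ∘ₗ D = LinearMap.id := by
  have hD' : ∀ c, D (p c) = TensorProduct.map p p (Coalgebra.comul (R := k) c) :=
    fun c => LinearMap.congr_fun hD c
  have he' : ∀ c, e (p c) = Coalgebra.counit (R := k) c := fun c => LinearMap.congr_fun he c
  refine ⟨?_, ?_, ?_⟩
  · ext q
    obtain ⟨c, rfl⟩ := hp q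
    have h := congrArg (TensorProduct.map p (TensorProduct.map p p))
      (Coalgebra.coassoc_apply (R := k) c)
    simp only [LinearMap.comp_apply, LinearEquiv.coe_coe, hD']
    convert h using 1
    · induction Coalgebra.comul (R := k) c with
      | zero => simp
      | add u v hu hv => simp only [map_add, hu, hv]
      | tmul x y =>
        simp only [TensorProduct.map_tmul, LinearMap.rTensor_tmul, hD', LinearMap.id_apply]
        induction Coalgebra.comul (R := k) x with
        | zero => simp
        | add u v hu hv => simp only [map_add, TensorProduct.add_tmul, hu, hv]
        | tmul u v => simp
    · induction Coalgebra.comul (R := k) c with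
      | zero => simp
      | add u v hu hv => simp only [map_add, hu, hv]
      | tmul x y =>
        simp only [TensorProduct.map_tmul, LinearMap.lTensor_tmul, hD', LinearMap.id_apply]
  · ext q
    obtain ⟨c, rfl⟩ := hp q
    have h := congrArg (fun z => p (TensorProduct.lid k C z))
      (Coalgebra.rTensor_counit_comul (R := k) c)
    simp only [TensorProduct.lid_tmul, one_smul] at h
    simp only [LinearMap.comp_apply, LinearEquiv.coe_coe, hD', LinearMap.id_apply]
    refine Eq.trans ?_ h
    induction Coalgebra.comul (R := k) c with
    | zero => simp
    | add u v hu hv => simp only [map_add, hu, hv]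
    | tmul x y => simp [he']
  · ext q
    obtain ⟨c, rfl⟩ := hp q
    have h := congrArg (fun z => p (TensorProduct.rid k C z))
      (Coalgebra.lTensor_counit_comul (R := k) c)
    simp only [TensorProduct.rid_tmul, one_smul] at h
    simp only [LinearMap.comp_apply, LinearEquiv.coe_coe, hD', LinearMap.id_apply]
    refine Eq.trans ?_ h
    induction Coalgebra.comul (R := k) c with
    | zero => simp
    | add u v hu hv => simp only [map_add, hu, hv]
    | tmul x y => simp [he']

end Helpers

theorem stmt3 (k B : Type*) [Field k] [Ring B] [Bialgebra k B] :
    ∃ (Δ' : Oslash k B →ₗ[k] Oslash k B ⊗[k] Oslash k B) (ε' : Oslash k B →ₗ[k] k)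
      (μ : (B ⊗[k] B) →ₗ[k] Oslash k B →ₗ[k] Oslash k B),
      Δ' ∘ₗ (oslashRel k B).mkQ
          = (TensorProduct.map (oslashRel k B).mkQ (oslashRel k B).mkQ) ∘ₗ coDelta0 k B ∧
      ε' ∘ₗ (oslashRel k B).mkQ
          = LinearMap.mul' k k ∘ₗ TensorProduct.map Coalgebra.counit Coalgebra.counit ∧
      (∀ (m z : B ⊗[k] B), μ m (omk k z) = omk k (m * z)) ∧
      (∀ m m' : B ⊗[k] B, μ (m * m') = μ m ∘ₗ μ m') ∧
      μ 1 = LinearMap.id ∧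
      (TensorProduct.assoc k (Oslash k B) (Oslash k B) (Oslash k B)).toLinearMap ∘ₗ
          (TensorProduct.map Δ' LinearMap.id) ∘ₗ Δ'
        = (TensorProduct.map LinearMap.id Δ') ∘ₗ Δ' ∧
      (TensorProduct.lid k (Oslash k B)).toLinearMap ∘ₗ
          (TensorProduct.map ε' LinearMap.id) ∘ₗ Δ' = LinearMap.id ∧
      (TensorProduct.rid k (Oslash k B)).toLinearMap ∘ₗ
          (TensorProduct.map LinearMap.id ε') ∘ₗ Δ' = LinearMap.id := by
  refine ⟨(oslashRel k B).liftQ _ rel_le_ker_comul, (oslashRel k B).liftQ _ rel_le_ker_counit,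
    muMap k B, Submodule.liftQ_mkQ _ _ _, Submodule.liftQ_mkQ _ _ _, muMap_mk, ?_, ?_, ?_⟩
  · intro m m'
    apply Submodule.linearMap_qext
    refine LinearMap.ext fun z => ?_
    exact congrArg (omk k) (mul_assoc m m' z)
  · apply Submodule.linearMap_qext
    refine LinearMap.ext fun z => ?_
    exact congrArg (omk k) (one_mul z)
  · refine @quot_coalg k (B ⊗[k] B) (Oslash k B) _ _ _ (bbcop k B) _ _ (oslashRel k B).mkQ
      (Submodule.mkQ_surjective _) _ _ ?_ ?_
    · rw [Submodule.liftQ_mkQ]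
      exact congrArg (_ ∘ₗ ·) bbcop_comul.symm
    · rw [Submodule.liftQ_mkQ]
      exact bbcop_counit.symm
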